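/- Fix (z,w) ∈ Λ with representative sequence (z_i,w_i)_{i∈ℕ}. Suppose λ := lim_{n→∞} λ(n)/n and ξ := lim_{n→∞} ξ(n)/n exist with ξ > λ, that for each a ∈ {0,…,b−1} the digit frequency p_a(z,w) := lim_{n→∞} #{1 ≤ i ≤ n : w_i = a}/n exists, and that p_0(z,w) < 1 and p_{b−1}(z,w) < 1. Then A_{n,j}(z,w) = (j − λ(n))·Σ_{a=0}^{b−1} p_a(z,w)·log #J₂(a) + o(n) uniformly over λ(n) ≤ j ≤ ξ(n); precisely, for every ε > 0 there exists N ∈ ℕ such that for all n ≥ N and every integer j with λ(n) ≤ j ≤ ξ(n), |A_{n,j}(z,w) − (j − λ(n))·Σ_{a=0}^{b−1} p_a(z,w)·log #J₂(a)| ≤ εn. -/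

import Mathlib

open Set Filter Topology MeasureTheory
open scoped ENNReal NNReal Topology

noncomputable section

namespace ShrinkingRect

/-- The real number with 1-indexed base-`b` digit sequence `u` (digit `i` is `u i` for `i ≥ 1`). -/
def val (b : ℕ) (u : ℕ → ℕ) : ℝ := ∑' i : ℕ, (u (i + 1) : ℝ) / (b : ℝ) ^ (i + 1)

/-- The self-similar carpet `Λ` with digit set `J ⊆ {0,…,b−1}²`. -/
def carpet (b : ℕ) (J : Finset (ℕ × ℕ)) : Set (ℝ × ℝ) :=
  {p | ∃ d : ℕ → ℕ × ℕ, (∀ i, 1 ≤ i → d i ∈ J) ∧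
    p = (val b (fun i => (d i).1), val b (fun i => (d i).2))}

/-- `J₂(a)`: the digits of `J` lying in row `a`. -/
def J2 (J : Finset (ℕ × ℕ)) (a : ℕ) : Finset (ℕ × ℕ) := J.filter fun p => p.2 = a

/-- The contraction `f_{u,v}(x,y) = ((x+u)/b, (y+v)/b)`. -/
def fmap (b : ℕ) (uv : ℕ × ℕ) (p : ℝ × ℝ) : ℝ × ℝ :=
  ((p.1 + (uv.1 : ℝ)) / b, (p.2 + (uv.2 : ℝ)) / b)

/-- `f_t = f_{u₁,v₁} ∘ ⋯ ∘ f_{uₙ,vₙ}` for a finite word `t = ((u₁,v₁),…,(uₙ,vₙ))`. -/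
def fword (b : ℕ) (t : List (ℕ × ℕ)) (p : ℝ × ℝ) : ℝ × ℝ :=
  t.foldr (fmap b) p

/-- The limsup set `W_{λ,ξ}(z,w)`. -/
def Wset (b : ℕ) (J : Finset (ℕ × ℕ)) (lam xi : ℕ → ℕ) (z w : ℝ) : Set (ℝ × ℝ) :=
  {p | p ∈ carpet b J ∧
    {t : List (ℕ × ℕ) | t ≠ [] ∧ (∀ e ∈ t, e ∈ J) ∧
      |p.1 - (fword b t (z, w)).1| ≤ (b : ℝ) ^ (-(lam t.length : ℤ) - (t.length : ℤ)) ∧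
      |p.2 - (fword b t (z, w)).2| ≤ (b : ℝ) ^ (-(xi t.length : ℤ) - (t.length : ℤ))}.Infinite}

/-- The closeness condition (in one coordinate) defining `M_n(z,w)`:
`xd` is the digit string of the point, `zd` that of the centre, `L` is `λ(n)` or `ξ(n)`. -/
def closeCond (b L n : ℕ) (zd xd : ℕ → ℕ) : Prop :=
  (∀ i, 1 ≤ i → i < L → xd (i + n) = zd i) ∨
  (∃ j, 1 ≤ j ∧ j < L ∧ (∀ i, 1 ≤ i → i ≤ j - 1 → xd (i + n) = zd i) ∧
    (((xd (j + n) : ℤ) - (zd j : ℤ) = -1 ∧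
        ∀ i, j + 1 ≤ i → i < L → (xd (i + n) : ℤ) - (zd i : ℤ) = (b : ℤ) - 1) ∨
     ((xd (j + n) : ℤ) - (zd j : ℤ) = 1 ∧
        ∀ i, j + 1 ≤ i → i < L → (zd i : ℤ) - (xd (i + n) : ℤ) = (b : ℤ) - 1)))

/-- A choice of representative digit sequences for the points of the carpet: each point of `Λ`
gets a digit sequence in `J` representing it, whose partial products of row cardinalities
`∏ #J₂(y_i)` are eventually maximal among all representations of that point. -/
structure RepMap (b : ℕ) (J : Finset (ℕ × ℕ)) where
  rep : ℝ × ℝ → ℕ → ℕ × ℕ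
  mem_J : ∀ p ∈ carpet b J, ∀ i, 1 ≤ i → rep p i ∈ J
  eq_val : ∀ p ∈ carpet b J,
    p = (val b (fun i => (rep p i).1), val b (fun i => (rep p i).2))
  maximal : ∀ p ∈ carpet b J, ∀ d : ℕ → ℕ × ℕ, (∀ i, 1 ≤ i → d i ∈ J) →
    p = (val b (fun i => (d i).1), val b (fun i => (d i).2)) →
    ∃ N₀ : ℕ, ∀ N, N₀ ≤ N →
      ∏ i ∈ Finset.Icc 1 N, (J2 J (d i).2).card ≤
        ∏ i ∈ Finset.Icc 1 N, (J2 J (rep p i).2).card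

/-- The expanding map `T(x,y) = (bx − x₁, by − y₁)`, where `(x_i,y_i)` is the representative
digit sequence of `(x,y)`. -/
def Tmap {b : ℕ} {J : Finset (ℕ × ℕ)} (R : RepMap b J) (p : ℝ × ℝ) : ℝ × ℝ :=
  ((b : ℝ) * p.1 - ((R.rep p 1).1 : ℝ), (b : ℝ) * p.2 - ((R.rep p 1).2 : ℝ))

/-- The shrinking target set `Λ_{λ,ξ}(z,w)`. -/
def targetSet {b : ℕ} {J : Finset (ℕ × ℕ)} (R : RepMap b J) (lam xi : ℕ → ℕ)
    (z w : ℝ) : Set (ℝ × ℝ) :=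
  {p | p ∈ carpet b J ∧ ∃ᶠ n in atTop,
    ((Tmap R)^[n] p).1 ∈ Icc (z - (b : ℝ) ^ (-(lam n : ℤ))) (z + (b : ℝ) ^ (-(lam n : ℤ))) ∧
    ((Tmap R)^[n] p).2 ∈ Icc (w - (b : ℝ) ^ (-(xi n : ℤ))) (w + (b : ℝ) ^ (-(xi n : ℤ)))}

/-- The set `M_n(z,w)` (as a set of points of `Λ`, via representative sequences). -/
def Mset {b : ℕ} {J : Finset (ℕ × ℕ)} (R : RepMap b J) (lam xi : ℕ → ℕ)
    (zw : ℝ × ℝ) (n : ℕ) : Set (ℝ × ℝ) :=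
  {p | p ∈ carpet b J ∧
    closeCond b (lam n) n (fun i => (R.rep zw i).1) (fun i => (R.rep p i).1) ∧
    closeCond b (xi n) n (fun i => (R.rep zw i).2) (fun i => (R.rep p i).2)}

/-- `p_{n,j}(a,y) = #{λ(n) ≤ i ≤ j : y_{i+n} = a}`. -/
def pcount {b : ℕ} {J : Finset (ℕ × ℕ)} (R : RepMap b J) (lam : ℕ → ℕ)
    (p : ℝ × ℝ) (a n j : ℕ) : ℕ :=
  ((Finset.Icc (lam n) j).filter fun i => (R.rep p (i + n)).2 = a).card

/-- `A_{n,j}(z,w) = max_{(x,y) ∈ M_n(z,w)} Σ_a p_{n,j}(a,y) log #J₂(a)`. -/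
def Aval {b : ℕ} {J : Finset (ℕ × ℕ)} (R : RepMap b J) (lam xi : ℕ → ℕ)
    (zw : ℝ × ℝ) (n j : ℕ) : ℝ :=
  sSup ((fun p => ∑ a ∈ Finset.range b,
    (pcount R lam p a n j : ℝ) * Real.log ((J2 J a).card)) '' Mset R lam xi zw n)

/-- `s_n = min{ (n log #J + A_{n,j}(z,w)) / ((n+j) log b) : λ(n) ≤ j ≤ ξ(n) }`. -/
def sval {b : ℕ} {J : Finset (ℕ × ℕ)} (R : RepMap b J) (lam xi : ℕ → ℕ)
    (zw : ℝ × ℝ) (n : ℕ) : ℝ :=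
  sInf ((fun j : ℕ => ((n : ℝ) * Real.log J.card + Aval R lam xi zw n j) /
    (((n : ℝ) + (j : ℝ)) * Real.log b)) '' Set.Icc (lam n) (xi n))

/-- `#{1 ≤ i ≤ n : u i = a}`. -/
def freqCount (u : ℕ → ℕ) (a n : ℕ) : ℕ := ((Finset.Icc 1 n).filter fun i => u i = a).card

/-- The second-coordinate digit string of the representative sequence of a point. -/
def wdig {b : ℕ} {J : Finset (ℕ × ℕ)} (R : RepMap b J) (zw : ℝ × ℝ) (i : ℕ) : ℕ :=
  (R.rep zw i).2

lemma summable_digits {b : ℕ} (hb : 2 ≤ b) {u : ℕ → ℕ} (hu : ∀ i, 1 ≤ i → u i < b) :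
    Summable fun i : ℕ => (u (i + 1) : ℝ) / (b : ℝ) ^ (i + 1) := by
  have hb1 : (1 : ℝ) < b := by exact_mod_cast hb
  have hg : Summable fun i : ℕ => ((b : ℝ)⁻¹) ^ i :=
    summable_geometric_of_lt_one (by positivity) (inv_lt_one_of_one_lt₀ hb1)
  refine Summable.of_nonneg_of_le (fun i => by positivity) (fun i => ?_) hg
  have h : (u (i + 1) : ℝ) ≤ b := by exact_mod_cast (hu (i + 1) (by omega)).le
  rw [inv_pow, div_le_iff₀ (by positivity), pow_succ,
    inv_mul_cancel_left₀ (by positivity)]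
  exact h

lemma val_nonneg (b : ℕ) (u : ℕ → ℕ) : 0 ≤ val b u :=
  tsum_nonneg fun i => by positivity

lemma val_le_one {b : ℕ} (hb : 2 ≤ b) {u : ℕ → ℕ} (hu : ∀ i, 1 ≤ i → u i < b) :
    val b u ≤ 1 := by
  have hb1 : (1 : ℝ) < b := by exact_mod_cast hb
  have hg := (hasSum_geometric_of_lt_one (r := (b : ℝ)⁻¹) (by positivity)
    (inv_lt_one_of_one_lt₀ hb1)).mul_left (((b : ℝ) - 1) / b)
  have hone : ((b : ℝ) - 1) / b * (1 - (b : ℝ)⁻¹)⁻¹ = 1 := by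
    have : (b : ℝ) - 1 ≠ 0 := by linarith
    field_simp
  rw [hone] at hg
  rw [← hg.tsum_eq]
  refine (summable_digits hb hu).tsum_le_tsum (fun i => ?_) hg.summable
  have h : (u (i + 1) : ℝ) ≤ (b : ℝ) - 1 := by
    have : (u (i + 1) : ℝ) + 1 ≤ b := by exact_mod_cast hu (i + 1) (by omega)
    linarith
  rw [inv_pow, ← div_eq_mul_inv, div_div, ← pow_succ']
  gcongr

lemma mul_val_eq {b : ℕ} (hb : 2 ≤ b) {u : ℕ → ℕ} (hu : ∀ i, 1 ≤ i → u i < b) :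
    (b : ℝ) * val b u = u 1 + val b fun i => u (i + 1) := by
  have hb0 : (b : ℝ) ≠ 0 := by positivity
  unfold val
  rw [(summable_digits hb hu).tsum_eq_zero_add, mul_add, ← tsum_mul_left]
  congr 1
  · field_simp
    simp [mul_comm]
  · refine tsum_congr fun i => ?_
    rw [pow_succ _ (i + 1)]
    field_simp

lemma digits_eq_zero_of_val_eq_zero {b : ℕ} (hb : 2 ≤ b) (i : ℕ) :
    ∀ {u : ℕ → ℕ}, (∀ i, 1 ≤ i → u i < b) → val b u = 0 → u (i + 1) = 0 := by
  induction i with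
  | zero =>
    intro u hu h
    have h1 := mul_val_eq hb hu
    have h2 := val_nonneg b fun i => u (i + 1)
    rw [h, mul_zero] at h1
    have : (u 1 : ℝ) ≤ 0 := by linarith
    exact_mod_cast this.antisymm (by positivity)
  | succ i ih =>
    intro u hu h
    have h1 := mul_val_eq hb hu
    have h2 := val_nonneg b fun i => u (i + 1)
    rw [h, mul_zero] at h1
    have : (0 : ℝ) ≤ u 1 := by positivity
    exact ih (u := fun i => u (i + 1)) (fun i _ => hu _ (by omega)) (by linarith)

lemma digits_eq_pred_of_val_eq_one {b : ℕ} (hb : 2 ≤ b) (i : ℕ) :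
    ∀ {u : ℕ → ℕ}, (∀ i, 1 ≤ i → u i < b) → val b u = 1 → u (i + 1) + 1 = b := by
  have aux : ∀ {u : ℕ → ℕ}, (∀ i, 1 ≤ i → u i < b) → val b u = 1 →
      u 1 + 1 = b ∧ val b (fun i => u (i + 1)) = 1 := by
    intro u hu h
    have h1 := mul_val_eq hb hu
    have h2 := val_le_one hb (u := fun i => u (i + 1)) fun i _ => hu _ (by omega)
    rw [h, mul_one] at h1
    have h3 : (u 1 : ℝ) + 1 ≤ b := by exact_mod_cast hu 1 le_rfl
    have h4 : (u 1 : ℝ) + 1 = b := by linarith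
    exact ⟨by exact_mod_cast h4, by linarith⟩
  induction i with
  | zero => exact fun hu h => (aux hu h).1
  | succ i ih =>
    intro u hu h
    exact ih (u := fun i => u (i + 1)) (fun i _ => hu _ (by omega)) (aux hu h).2

lemma val_shift_eq {b : ℕ} (hb : 2 ≤ b) (k : ℕ) :
    ∀ {u v : ℕ → ℕ}, (∀ i, 1 ≤ i → u i < b) → (∀ i, 1 ≤ i → v i < b) → val b u = val b v →
      (∀ i, 1 ≤ i → i ≤ k → u i = v i) →
      val b (fun i => u (i + k)) = val b fun i => v (i + k) := by
  induction k with
  | zero => exact fun _ _ h _ => h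
  | succ k ih =>
    intro u v hu hv h huv
    have hus := mul_val_eq hb hu
    have hvs := mul_val_eq hb hv
    rw [h, huv 1 le_rfl (by omega)] at hus
    have := ih (u := fun i => u (i + 1)) (v := fun i => v (i + 1)) (fun i _ => hu _ (by omega))
      (fun i _ => hv _ (by omega)) (by linarith) fun i _ _ => huv _ (by omega) (by omega)
    simpa only [add_assoc, add_comm 1 k] using this

/-- At a first difference, the smaller of two expansions of the same number continues with
digits `b - 1` and the larger one with digits `0`. -/
lemma digits_after_first_lt {b : ℕ} (hb : 2 ≤ b) {u v : ℕ → ℕ} (hu : ∀ i, 1 ≤ i → u i < b)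
    (hv : ∀ i, 1 ≤ i → v i < b) (h : val b u = val b v) {k : ℕ} (hk : 1 ≤ k)
    (huv : ∀ i, 1 ≤ i → i < k → u i = v i) (hlt : u k < v k) :
    v k = u k + 1 ∧ ∀ i, k < i → u i + 1 = b ∧ v i = 0 := by
  obtain ⟨k, rfl⟩ : ∃ m, k = m + 1 := ⟨k - 1, by omega⟩
  have hs := val_shift_eq hb k hu hv h fun i h1 h2 => huv i h1 (by omega)
  have hus := mul_val_eq hb (u := fun i => u (i + k)) fun i _ => hu _ (by omega)
  have hvs := mul_val_eq hb (u := fun i => v (i + k)) fun i _ => hv _ (by omega)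
  rw [hs, hvs] at hus
  have hu' : ∀ i, 1 ≤ i → u (i + 1 + k) < b := fun i _ => hu _ (by omega)
  have hv' : ∀ i, 1 ≤ i → v (i + 1 + k) < b := fun i _ => hv _ (by omega)
  have hU := val_le_one hb (u := fun i => u (i + 1 + k)) hu'
  have hV := val_nonneg b fun i => v (i + 1 + k)
  simp only [add_comm 1 k] at hus
  have hlt' : (u (k + 1) : ℝ) + 1 ≤ v (k + 1) := by exact_mod_cast hlt
  have hd : (v (k + 1) : ℝ) = u (k + 1) + 1 := by linarith
  refine ⟨by exact_mod_cast hd, fun i hi => ?_⟩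
  obtain ⟨m, rfl⟩ : ∃ m, i = m + 1 + 1 + k := ⟨i - k - 2, by omega⟩
  exact ⟨digits_eq_pred_of_val_eq_one hb m (u := fun i => u (i + 1 + k)) hu' (by linarith),
    digits_eq_zero_of_val_eq_zero hb m (u := fun i => v (i + 1 + k)) hv' (by linarith)⟩

/-- The sequence `n` copies of `d 1` followed by `d 1, d 2, …`. -/
def prependFirst {α : Type*} (n : ℕ) (d : ℕ → α) (i : ℕ) : α := if i ≤ n then d 1 else d (i - n)

lemma prependFirst_of_le {α : Type*} {n i : ℕ} (d : ℕ → α) (h : i ≤ n) : prependFirst n d i = d 1 :=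
  if_pos h

lemma prependFirst_add {α : Type*} (n : ℕ) (d : ℕ → α) {i : ℕ} (h : 1 ≤ i) :
    prependFirst n d (i + n) = d i := by
  rw [prependFirst, if_neg (by omega), Nat.add_sub_cancel]

lemma closeCond_of_val_prependFirst_eq {b : ℕ} (hb : 2 ≤ b) (L n : ℕ) {u v : ℕ → ℕ}
    (hu : ∀ i, 1 ≤ i → u i < b) (hv : ∀ i, 1 ≤ i → v i < b)
    (h : val b (prependFirst n u) = val b v) : closeCond b L n u v := by
  have hpu : ∀ i, 1 ≤ i → prependFirst n u i < b := by
    intro i hi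
    unfold prependFirst
    split_ifs
    · exact hu 1 le_rfl
    · exact hu _ (by omega)
  by_cases hex : ∃ k, 1 ≤ k ∧ prependFirst n u k ≠ v k
  · classical
    obtain ⟨hk1, hne⟩ := Nat.find_spec hex
    have hmin : ∀ i, 1 ≤ i → i < Nat.find hex → prependFirst n u i = v i := by
      intro i hi hik
      by_contra hc
      exact Nat.find_min hex hik ⟨hi, hc⟩
    generalize Nat.find hex = k at hk1 hne hmin
    have hcases : (v k = prependFirst n u k + 1 ∧ ∀ i, k < i → prependFirst n u i + 1 = b ∧ v i = 0) ∨
        (prependFirst n u k = v k + 1 ∧ ∀ i, k < i → v i + 1 = b ∧ prependFirst n u i = 0) := by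
      rcases lt_or_gt_of_ne hne with hlt | hlt
      · exact Or.inl (digits_after_first_lt hb hpu hv h hk1 hmin hlt)
      · exact Or.inr (digits_after_first_lt hb hv hpu h.symm hk1
          (fun i h1 h2 => (hmin i h1 h2).symm) hlt)
    have hnk : n < k := by
      by_contra hc
      have h1 := prependFirst_add n u (le_refl 1)
      rw [prependFirst_of_le u (by omega : k ≤ n)] at hcases
      rcases hcases with ⟨h2, h3⟩ | ⟨h2, h3⟩
      · have := (h3 (1 + n) (by omega)).1
        have := hv k hk1
        omega
      · have := (h3 (1 + n) (by omega)).2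
        omega
    obtain ⟨m, rfl⟩ : ∃ m, k = m + n := ⟨k - n, by omega⟩
    have heq : ∀ i, 1 ≤ i → i < m → v (i + n) = u i := by
      intro i h1 h2
      rw [← hmin (i + n) (by omega) (by omega), prependFirst_add n u h1]
    by_cases hmL : m < L
    · refine Or.inr ⟨m, by omega, hmL, fun i h1 h2 => heq i h1 (by omega), ?_⟩
      rw [prependFirst_add n u (by omega)] at hcases
      rcases hcases with ⟨h2, h3⟩ | ⟨h2, h3⟩
      · refine Or.inr ⟨by omega, fun i hi _ => ?_⟩
        have := h3 (i + n) (by omega)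
        rw [prependFirst_add n u (by omega)] at this
        omega
      · refine Or.inl ⟨by omega, fun i hi _ => ?_⟩
        have := h3 (i + n) (by omega)
        rw [prependFirst_add n u (by omega)] at this
        omega
    · exact Or.inl fun i h1 h2 => heq i h1 (by omega)
  · push Not at hex
    refine Or.inl fun i h1 _ => ?_
    rw [← hex (i + n) (by omega), prependFirst_add n u h1]

section

variable {b : ℕ} {J : Finset (ℕ × ℕ)}

lemma RepMap.fst_lt (R : RepMap b J) (hJ : J ⊆ Finset.range b ×ˢ Finset.range b) {q : ℝ × ℝ}
    (hq : q ∈ carpet b J) {i : ℕ} (hi : 1 ≤ i) : (R.rep q i).1 < b :=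
  Finset.mem_range.1 (Finset.mem_product.1 (hJ (R.mem_J q hq i hi))).1

lemma RepMap.snd_lt (R : RepMap b J) (hJ : J ⊆ Finset.range b ×ˢ Finset.range b) {q : ℝ × ℝ}
    (hq : q ∈ carpet b J) {i : ℕ} (hi : 1 ≤ i) : (R.rep q i).2 < b :=
  Finset.mem_range.1 (Finset.mem_product.1 (hJ (R.mem_J q hq i hi))).2

lemma Mset_nonempty (hb : 2 ≤ b) (hJ : J ⊆ Finset.range b ×ˢ Finset.range b) (R : RepMap b J)
    (lam xi : ℕ → ℕ) {zw : ℝ × ℝ} (hzw : zw ∈ carpet b J) (n : ℕ) :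
    (Mset R lam xi zw n).Nonempty := by
  have h1 : (fun i => (prependFirst n (R.rep zw) i).1) = prependFirst n fun i => (R.rep zw i).1 := by
    ext i
    unfold prependFirst
    split_ifs <;> rfl
  have h2 : (fun i => (prependFirst n (R.rep zw) i).2) = prependFirst n fun i => (R.rep zw i).2 := by
    ext i
    unfold prependFirst
    split_ifs <;> rfl
  have hq : (val b (prependFirst n fun i => (R.rep zw i).1),
      val b (prependFirst n fun i => (R.rep zw i).2)) ∈ carpet b J := by
    refine ⟨prependFirst n (R.rep zw), fun i hi => ?_, by rw [h1, h2]⟩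
    unfold prependFirst
    split_ifs
    · exact R.mem_J _ hzw 1 le_rfl
    · exact R.mem_J _ hzw _ (by omega)
  have hval := Prod.ext_iff.1 (R.eq_val _ hq)
  exact ⟨_, hq,
    closeCond_of_val_prependFirst_eq hb _ n (fun _ hi => R.fst_lt hJ hzw hi)
      (fun _ hi => R.fst_lt hJ hq hi) hval.1,
    closeCond_of_val_prependFirst_eq hb _ n (fun _ hi => R.snd_lt hJ hzw hi)
      (fun _ hi => R.snd_lt hJ hq hi) hval.2⟩

lemma freqCount_add_card (u : ℕ → ℕ) (a : ℕ) {m j : ℕ} (h : m ≤ j) :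
    freqCount u a j =
      freqCount u a m + ((Finset.Icc (m + 1) j).filter fun i => u i = a).card := by
  unfold freqCount
  rw [← Finset.card_union_of_disjoint, ← Finset.filter_union]
  · congr 2
    ext i
    simp only [Finset.mem_union, Finset.mem_Icc]
    omega
  · refine Finset.disjoint_left.2 fun i h1 h2 => ?_
    simp only [Finset.mem_filter, Finset.mem_Icc] at h1 h2
    omega

lemma abs_card_filter_sub_card_filter_le (s : Finset ℕ) (u v : ℕ → ℕ) (a : ℕ) :
    |((s.filter fun i => v i = a).card : ℝ) - (s.filter fun i => u i = a).card| ≤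
      (s.filter fun i => v i ≠ u i).card := by
  have key : ∀ u v : ℕ → ℕ, (s.filter fun i => v i = a).card ≤
      (s.filter fun i => u i = a).card + (s.filter fun i => v i ≠ u i).card := by
    intro u v
    refine le_trans (Finset.card_le_card fun i hi => ?_) (Finset.card_union_le _ _)
    simp only [Finset.mem_filter, Finset.mem_union] at hi ⊢
    by_cases h : v i = u i
    · exact Or.inl ⟨hi.1, h ▸ hi.2⟩
    · exact Or.inr ⟨hi.1, h⟩
  have h1 := key u v
  have h2 := key v u
  simp only [ne_comm (a := u _)] at h2
  rw [abs_sub_le_iff]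
  constructor
  · have : ((s.filter fun i => v i = a).card : ℝ) ≤
      (s.filter fun i => u i = a).card + (s.filter fun i => v i ≠ u i).card := by exact_mod_cast h1
    linarith
  · have : ((s.filter fun i => u i = a).card : ℝ) ≤
      (s.filter fun i => v i = a).card + (s.filter fun i => v i ≠ u i).card := by exact_mod_cast h2
    linarith

/-- If `c k / k → q` then `c k = q k + o(n)` uniformly over `k ≤ m n`, when `m n = O(n)`. -/
lemma eventually_forall_abs_sub_le {c : ℕ → ℝ} {q y : ℝ} {m : ℕ → ℕ}
    (hc : Tendsto (fun n : ℕ => c n / n) atTop (𝓝 q))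
    (hm : Tendsto (fun n : ℕ => (m n : ℝ) / n) atTop (𝓝 y)) {δ : ℝ} (hδ : 0 < δ) :
    ∀ᶠ n : ℕ in atTop, ∀ k ≤ m n, |c k - q * k| ≤ δ * n := by
  have hy : 0 ≤ y := ge_of_tendsto' hm fun n => by positivity
  have hC : (0 : ℝ) < y + 1 := by linarith
  obtain ⟨K, hK⟩ := eventually_atTop.1 (Metric.tendsto_nhds.1 hc (δ / (y + 1)) (by positivity))
  have hB : ∀ᶠ n : ℕ in atTop, ∀ k ∈ Finset.range (K + 1), |c k - q * k| ≤ δ * n := by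
    rw [Filter.eventually_all_finset]
    exact fun k _ => (tendsto_natCast_atTop_atTop.const_mul_atTop hδ).eventually_ge_atTop _
  filter_upwards [hB, hm.eventually_lt_const (lt_add_one y), eventually_gt_atTop 0]
    with n hn hmn hn0 k hk
  by_cases hkK : k ≤ K
  · exact hn k (Finset.mem_range.2 (by omega))
  · have hk0 : (0 : ℝ) < k := by exact_mod_cast (by omega : 0 < k)
    have hn0' : (0 : ℝ) < n := by exact_mod_cast hn0
    have h1 := hK k (by omega)
    rw [Real.dist_eq] at h1
    have h2 : c k - q * k = (c k / k - q) * k := by field_simp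
    have h3 : (k : ℝ) ≤ (y + 1) * n := by
      rw [div_lt_iff₀ hn0'] at hmn
      exact (Nat.cast_le.2 hk).trans hmn.le
    rw [h2, abs_mul, abs_of_pos hk0]
    calc |c k / k - q| * k ≤ δ / (y + 1) * ((y + 1) * n) := by gcongr
      _ = δ * n := by field_simp

/-- Two digit strings satisfying `closeCond` differ in few places, provided the digits `0` and
`b - 1` do not have full frequency in the first one. -/
lemma card_mismatch_le {L n : ℕ} {u v : ℕ → ℕ} (hu : ∀ i, 1 ≤ i → u i < b)
    (hv : ∀ i, 1 ≤ i → v i < b) (h : closeCond b L n u v) {q : ℕ → ℝ} {D : ℝ} (hD : 0 ≤ D)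
    (hq0 : q 0 < 1) (hqb : q (b - 1) < 1)
    (hf : ∀ a, a = 0 ∨ a = b - 1 → ∀ k ≤ L, |(freqCount u a k : ℝ) - q a * k| ≤ D * (1 - q a)) :
    (((Finset.Icc 1 L).filter fun i => v (i + n) ≠ u i).card : ℝ) ≤ 2 * D + 2 := by
  rcases h with h | ⟨j, hj1, hjL, hagree, htail⟩
  · have hsub : ((Finset.Icc 1 L).filter fun i => v (i + n) ≠ u i) ⊆ {L} := by
      intro i hi
      simp only [Finset.mem_filter, Finset.mem_Icc, Finset.mem_singleton] at hi ⊢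
      by_contra hc
      exact hi.2 (h i hi.1.1 (by omega))
    have : (((Finset.Icc 1 L).filter fun i => v (i + n) ≠ u i).card : ℝ) ≤ 1 := by
      exact_mod_cast (Finset.card_le_card hsub).trans (Finset.card_singleton L).le
    linarith
  · have hconst : ∃ a, (a = 0 ∨ a = b - 1) ∧ ∀ i, j + 1 ≤ i → i < L → u i = a := by
      rcases htail with ⟨-, ht⟩ | ⟨-, ht⟩
      · refine ⟨0, Or.inl rfl, fun i h1 h2 => ?_⟩
        have := ht i h1 h2
        have := hv (i + n) (by omega)
        omega
      · refine ⟨b - 1, Or.inr rfl, fun i h1 h2 => ?_⟩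
        have := ht i h1 h2
        have := hu i (by omega)
        omega
    obtain ⟨a, ha, hrun⟩ := hconst
    have hqa : 0 < 1 - q a := by rcases ha with rfl | rfl <;> linarith
    obtain ⟨r, rfl⟩ : ∃ r, L = j + r + 1 := ⟨L - j - 1, by omega⟩
    have hcount : freqCount u a (j + r) = freqCount u a j + r := by
      rw [freqCount_add_card u a (Nat.le_add_right j r), Finset.filter_true_of_mem]
      · simp
      · intro i hi
        rw [Finset.mem_Icc] at hi
        exact hrun i hi.1 (by omega)
    have h1 := (abs_le.1 (hf a ha (j + r) (by omega))).2
    have h2 := (abs_le.1 (hf a ha j (by omega))).1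
    rw [hcount] at h1
    push_cast at h1
    have hr : (r : ℝ) ≤ 2 * D := by
      refine le_of_mul_le_mul_right ?_ hqa
      linarith
    have hsub : ((Finset.Icc 1 (j + r + 1)).filter fun i => v (i + n) ≠ u i) ⊆
        Finset.Icc j (j + r + 1) := by
      intro i hi
      simp only [Finset.mem_filter, Finset.mem_Icc] at hi ⊢
      by_contra hc
      exact hi.2 (hagree i hi.1.1 (by omega))
    have hcard := Finset.card_le_card hsub
    rw [Nat.card_Icc] at hcard
    have : (((Finset.Icc 1 (j + r + 1)).filter fun i => v (i + n) ≠ u i).card : ℝ) ≤ r + 2 := by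
      exact_mod_cast hcard.trans (by omega)
    linarith

lemma abs_csSup_sub_le {s : Set ℝ} (hs : s.Nonempty) {t e : ℝ} (h : ∀ y ∈ s, |y - t| ≤ e) :
    |sSup s - t| ≤ e := by
  have hub : ∀ y ∈ s, y ≤ t + e := fun y hy => by linarith [(abs_le.1 (h y hy)).2]
  obtain ⟨y, hy⟩ := hs
  have h1 := csSup_le ⟨y, hy⟩ hub
  have h2 := le_csSup ⟨t + e, hub⟩ hy
  have h3 := (abs_le.1 (h y hy)).1
  exact abs_le.2 ⟨by linarith, by linarith⟩

/-- Uniformly over `M_n(z,w)` and `λ(n) ≤ j ≤ ξ(n)`, the counts `p_{n,j}(a,y)` are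
`(j - λ(n)) p_a + o(n)`. -/
lemma eventually_forall_abs_pcount_sub_le (hJ : J ⊆ Finset.range b ×ˢ Finset.range b)
    (hb : 2 ≤ b) (R : RepMap b J) {lam xi : ℕ → ℕ} (hlam_pos : ∀ n, 1 ≤ lam n) {zw : ℝ × ℝ}
    (hzw : zw ∈ carpet b J) {y : ℝ}
    (hxi : Tendsto (fun n : ℕ => (xi n : ℝ) / n) atTop (𝓝 y)) {q : ℕ → ℝ}
    (hq : ∀ a, a < b →
      Tendsto (fun n : ℕ => (freqCount (wdig R zw) a n : ℝ) / n) atTop (𝓝 (q a)))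
    (hq0 : q 0 < 1) (hqb : q (b - 1) < 1) {δ : ℝ} (hδ : 0 < δ) :
    ∀ᶠ n : ℕ in atTop, ∀ j, lam n ≤ j → j ≤ xi n → ∀ pt ∈ Mset R lam xi zw n,
      ∀ a ∈ Finset.range b,
        |(pcount R lam pt a n j : ℝ) - ((j : ℝ) - lam n) * q a| ≤ 7 * δ * n := by
  have hsmall : ∀ c : ℝ, ∀ᶠ n : ℕ in atTop, c ≤ δ * n := fun c =>
    (tendsto_natCast_atTop_atTop.const_mul_atTop hδ).eventually_ge_atTop c
  have hfreq : ∀ᶠ n : ℕ in atTop, ∀ a ∈ Finset.range b, ∀ k ≤ xi n,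
      |(freqCount (wdig R zw) a k : ℝ) - q a * k| ≤ δ * n := by
    rw [Filter.eventually_all_finset]
    exact fun a ha => eventually_forall_abs_sub_le (hq a (Finset.mem_range.1 ha)) hxi hδ
  have hq_small : ∀ᶠ n : ℕ in atTop, ∀ a ∈ Finset.range b, |q a| ≤ δ * n := by
    rw [Filter.eventually_all_finset]
    exact fun a _ => hsmall _
  have hend : ∀ a, a < b → q a < 1 → ∀ᶠ n : ℕ in atTop, ∀ k ≤ xi n,
      |(freqCount (wdig R zw) a k : ℝ) - q a * k| ≤ δ * (1 - q a) * n := fun a ha ha1 =>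
    eventually_forall_abs_sub_le (hq a ha) hxi (mul_pos hδ (by linarith))
  filter_upwards [hfreq, hq_small, hend 0 (by omega) hq0, hend (b - 1) (by omega) hqb, hsmall 2]
    with n hn hqn hn0 hnb hn2 j hlj hjx pt hpt a ha
  obtain ⟨hptc, -, hclose⟩ := hpt
  have hmis := card_mismatch_le (D := δ * n) (fun i hi => R.snd_lt hJ hzw hi)
    (fun i hi => R.snd_lt hJ hptc hi) hclose (by positivity) hq0 hqb (by
      rintro c (rfl | rfl) k hk
      · exact (hn0 k hk).trans_eq (by ring)
      · exact (hnb k hk).trans_eq (by ring))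
  have hdiff := abs_card_filter_sub_card_filter_le (Finset.Icc (lam n) j) (wdig R zw)
    (fun i => (R.rep pt (i + n)).2) a
  have hsub : (((Finset.Icc (lam n) j).filter
      fun i => (R.rep pt (i + n)).2 ≠ wdig R zw i).card : ℝ) ≤ 2 * (δ * n) + 2 := by
    refine le_trans (Nat.cast_le.2 (Finset.card_le_card ?_)) hmis
    exact Finset.filter_subset_filter _ (Finset.Icc_subset_Icc (hlam_pos n) hjx)
  obtain ⟨m, hm⟩ : ∃ m, lam n = m + 1 := ⟨lam n - 1, by have := hlam_pos n; omega⟩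
  have hadd := freqCount_add_card (wdig R zw) a (by omega : m ≤ j)
  rw [← hm] at hadd
  have hadd' : (freqCount (wdig R zw) a j : ℝ) = freqCount (wdig R zw) a m +
      ((Finset.Icc (lam n) j).filter fun i => wdig R zw i = a).card := by exact_mod_cast hadd
  have hm' : (lam n : ℝ) = m + 1 := by exact_mod_cast hm
  have h1 := abs_le.1 (hn a ha j hjx)
  have h2 := abs_le.1 (hn a ha m (by omega))
  have h3 := abs_le.1 (hqn a ha)
  have h4 := abs_le.1 (hdiff.trans hsub)
  rw [abs_le, hm']
  unfold pcount
  constructor <;> linarith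

end

theorem stmt_12
    (b : ℕ) (J : Finset (ℕ × ℕ)) (hb : 2 ≤ b)
    (hJ : J ⊂ Finset.range b ×ˢ Finset.range b) (hJcard : 2 ≤ J.card)
    (R : RepMap b J) (lam xi : ℕ → ℕ)
    (hlam_pos : ∀ n, 1 ≤ lam n) (hle : ∀ n, lam n ≤ xi n)
    (hlam_top : Tendsto lam atTop atTop)
    (z w : ℝ) (hzw : (z, w) ∈ carpet b J)
    (l x : ℝ)
    (hl : Tendsto (fun n : ℕ => (lam n : ℝ) / n) atTop (𝓝 l))
    (hx : Tendsto (fun n : ℕ => (xi n : ℝ) / n) atTop (𝓝 x))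
    (hlx : l < x)
    (p : ℕ → ℝ)
    (hp : ∀ a, a < b →
      Tendsto (fun n : ℕ => (freqCount (wdig R (z, w)) a n : ℝ) / n) atTop (𝓝 (p a)))
    (hp0 : p 0 < 1) (hpb : p (b - 1) < 1) :
    ∀ ε : ℝ, 0 < ε → ∃ N : ℕ, ∀ n, N ≤ n → ∀ j : ℕ, lam n ≤ j → j ≤ xi n →
      |Aval R lam xi (z, w) n j -
          ((j : ℝ) - (lam n : ℝ)) *
            (∑ a ∈ Finset.range b, p a * Real.log ((J2 J a).card))| ≤ ε * n := by
  intro ε hε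
  set S : ℝ := ∑ a ∈ Finset.range b, |Real.log ((J2 J a).card)|
  have hS : 0 ≤ S := Finset.sum_nonneg fun a _ => abs_nonneg _
  obtain ⟨N, hN⟩ := eventually_atTop.1 (eventually_forall_abs_pcount_sub_le hJ.subset hb R hlam_pos
    hzw hx hp hp0 hpb (δ := ε / (7 * (S + 1))) (by positivity))
  refine ⟨N, fun n hn j hlj hjx => abs_csSup_sub_le
    ((Mset_nonempty hb hJ.subset R lam xi hzw n).image _) ?_⟩
  rintro _ ⟨pt, hpt, rfl⟩
  rw [Finset.mul_sum, ← Finset.sum_sub_distrib]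
  calc |∑ a ∈ Finset.range b, ((pcount R lam pt a n j : ℝ) * Real.log ((J2 J a).card) -
          ((j : ℝ) - lam n) * (p a * Real.log ((J2 J a).card)))|
      ≤ ∑ a ∈ Finset.range b,
          7 * (ε / (7 * (S + 1))) * n * |Real.log ((J2 J a).card)| := by
        refine (Finset.abs_sum_le_sum_abs _ _).trans (Finset.sum_le_sum fun a ha => ?_)
        rw [← mul_assoc, ← sub_mul, abs_mul]
        exact mul_le_mul_of_nonneg_right (hN n hn j hlj hjx pt hpt a ha) (abs_nonneg _)
    _ = ε * n * (S / (S + 1)) := by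
        rw [← Finset.mul_sum]
        change 7 * (ε / (7 * (S + 1))) * n * S = _
        field_simp
    _ ≤ ε * n :=
        mul_le_of_le_one_right (by positivity) ((div_le_one (by positivity)).2 (by linarith))

end ShrinkingRect
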